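/- Two-channel LCT filter bank in polyphase form: let h₀, h₁, g₀, g₁, x : ℤ → ℂ be finitely supported with sampling period T, and let x̂ = Σ_{i=0}^{1} gᵢ ∗ up2( down2( hᵢ ∗ x ) ), where down2(u)(n) = u(2n) and up2(y)(2n) = y(n), up2(y)(m) = 0 for odd m. Let X_p(ω) = (X₀(ω), X₁(ω))ᵀ and X̂_p(ω) = (X̂₀(ω), X̂₁(ω))ᵀ be the DTLCT vectors (sampling period 2T) of the type-1 polyphase components of x and x̂, let H_p(ω) be the 2×2 matrix whose (i, j) entry is the DTLCT (period 2T) of the j-th type-2 polyphase component of hᵢ, and let G_p(ω) be the 2×2 matrix whose (j, i) entry is the DTLCT (period 2T) of the j-th type-1 polyphase component of gᵢ. Then for all ω ∈ ℝ, X̂_p(ω) = exp( −i·d·b·ω²/(4T²) )·G_p(ω)·H_p(ω)·X_p(ω). -/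

import Mathlib

open Real Complex Matrix

/-- Discrete-time linear canonical transform (constant prefactor omitted). -/
noncomputable def dtlct (a b d T : ℝ) (x : ℤ → ℂ) (ω : ℝ) : ℂ :=
  ∑ᶠ n : ℤ, x n * Complex.exp ((Complex.I / 2) *
    (((a / b) * (n : ℝ) ^ 2 * T ^ 2 - 2 * (n : ℝ) * ω + (d * b / T ^ 2) * ω ^ 2 : ℝ) : ℂ))

/-- LCT convolution at sampling period `T`. -/
noncomputable def lctConv (a b T : ℝ) (h x : ℤ → ℂ) (n : ℤ) : ℂ :=
  ∑ᶠ k : ℤ, h k * x (n - k) *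
    Complex.exp (-Complex.I * (((a * T ^ 2 / b) * (k : ℝ) * ((n : ℝ) - (k : ℝ)) : ℝ) : ℂ))

/-- Downsampling by 2. -/
def down2 (u : ℤ → ℂ) (n : ℤ) : ℂ := u (2 * n)

/-- Upsampling by 2. -/
noncomputable def up2 (y : ℤ → ℂ) (m : ℤ) : ℂ := if 2 ∣ m then y (m / 2) else 0

/-- Zeroth polyphase component (same for type 1 and type 2). -/
noncomputable def poly0 (x : ℤ → ℂ) (n : ℤ) : ℂ := x (2 * n)

/-- First type-1 polyphase component. -/
noncomputable def poly1T1 (a b T : ℝ) (x : ℤ → ℂ) (n : ℤ) : ℂ :=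
  x (2 * n - 1) * Complex.exp (Complex.I *
    (((a * T ^ 2 / (2 * b)) * (1 - 4 * (n : ℝ)) : ℝ) : ℂ))

/-- First type-2 polyphase component. -/
noncomputable def poly1T2 (a b T : ℝ) (x : ℤ → ℂ) (n : ℤ) : ℂ :=
  x (2 * n + 1) * Complex.exp (Complex.I *
    (((a * T ^ 2 / (2 * b)) * (4 * (n : ℝ) + 1) : ℝ) : ℂ))

/-- A finitely supported sum over the integers splits into its even and odd parts. -/
theorem finsum_int_eq_even_add_odd {M : Type*} [AddCommMonoid M] {f : ℤ → M}
    (hf : (Function.support f).Finite) :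
    ∑ᶠ k, f k = ∑ᶠ k, f (2 * k) + ∑ᶠ k, f (2 * k + 1) := by
  have hE : Function.Injective fun k : ℤ => 2 * k := fun x y h => by
    simp only at h; omega
  have hO : Function.Injective fun k : ℤ => 2 * k + 1 := fun x y h => by
    simp only at h; omega
  rw [← finsum_mem_range (f := f) hE, ← finsum_mem_range (f := f) hO,
    ← finsum_mem_union' _ (hf.inter_of_right _) (hf.inter_of_right _), ← finsum_mem_univ]
  · refine finsum_mem_congr (Set.eq_univ_of_forall fun k => ?_).symm fun _ _ => rfl
    rcases Int.even_or_odd' k with ⟨m, h | h⟩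
    · exact Or.inl ⟨m, h.symm⟩
    · exact Or.inr ⟨m, h.symm⟩
  · rw [Set.disjoint_left]
    rintro _ ⟨k, rfl⟩ ⟨m, hm⟩
    simp only at hm
    omega

theorem support_mul_finite_of_left {ι : Type*} {f : ι → ℂ} (hf : (Function.support f).Finite)
    (g : ι → ℂ) : (Function.support fun i => f i * g i).Finite :=
  hf.subset fun _ hi h => hi (by simp [h])

theorem support_poly0_finite {x : ℤ → ℂ} (hx : (Function.support x).Finite) :
    (Function.support (poly0 x)).Finite :=
  hx.preimage (f := fun n : ℤ => 2 * n) fun _ _ _ _ h => by simp only at h; omega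

theorem support_poly1T1_finite (a b T : ℝ) {x : ℤ → ℂ} (hx : (Function.support x).Finite) :
    (Function.support (poly1T1 a b T x)).Finite :=
  support_mul_finite_of_left
    (hx.preimage (f := fun n : ℤ => 2 * n - 1) fun _ _ _ _ h => by simp only at h; omega) _

theorem support_poly1T2_finite (a b T : ℝ) {x : ℤ → ℂ} (hx : (Function.support x).Finite) :
    (Function.support (poly1T2 a b T x)).Finite :=
  support_mul_finite_of_left
    (hx.preimage (f := fun n : ℤ => 2 * n + 1) fun _ _ _ _ h => by simp only at h; omega) _

theorem support_lctConv_finite (a b T : ℝ) {h x : ℤ → ℂ} (hh : (Function.support h).Finite)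
    (hx : (Function.support x).Finite) : (Function.support (lctConv a b T h x)).Finite := by
  refine (hh.image2 (· + ·) hx).subset fun n hn => ?_
  obtain ⟨k, hk⟩ := not_forall.mp (mt finsum_eq_zero_of_forall_eq_zero hn)
  exact ⟨k, fun h0 => hk (by simp [h0]), n - k, fun h0 => hk (by simp [h0]), by ring⟩

theorem dtlct_add (a b d T : ℝ) {x y : ℤ → ℂ} (hx : (Function.support x).Finite)
    (hy : (Function.support y).Finite) (ω : ℝ) :
    dtlct a b d T (fun n => x n + y n) ω = dtlct a b d T x ω + dtlct a b d T y ω := by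
  simp only [dtlct, add_mul]
  exact finsum_add_distrib (support_mul_finite_of_left hx _) (support_mul_finite_of_left hy _)

/-- The convolution theorem for the discrete-time linear canonical transform. -/
theorem dtlct_lctConv (a b d T : ℝ) {h x : ℤ → ℂ} (hh : (Function.support h).Finite)
    (hx : (Function.support x).Finite) (ω : ℝ) :
    dtlct a b d T (lctConv a b T h x) ω =
      Complex.exp (-Complex.I * ((d * b * ω ^ 2 / (2 * T ^ 2) : ℝ) : ℂ)) *
        (dtlct a b d T h ω * dtlct a b d T x ω) := by
  have key (n : ℤ) : lctConv a b T h x n = ∑ k ∈ hh.toFinset, h k * x (n - k) *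
      Complex.exp (-Complex.I *
        (((a * T ^ 2 / b) * (k : ℝ) * ((n : ℝ) - (k : ℝ)) : ℝ) : ℂ)) := by
    refine finsum_eq_sum_of_support_subset _ fun k hk => ?_
    simp only [Set.Finite.coe_toFinset]
    exact fun h0 => hk (by simp [h0])
  have hH := finsum_eq_sum_of_support_subset (s := hh.toFinset)
    (fun n : ℤ => h n * Complex.exp ((Complex.I / 2) *
      (((a / b) * (n : ℝ) ^ 2 * T ^ 2 - 2 * (n : ℝ) * ω + (d * b / T ^ 2) * ω ^ 2 : ℝ) : ℂ)))
    fun k hk => by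
      simp only [Set.Finite.coe_toFinset]
      exact fun h0 => hk (by simp [h0])
  have hxs (k : ℤ) : (Function.support fun n => x (n - k)).Finite :=
    hx.preimage (f := fun n : ℤ => n - k) fun _ _ _ _ h => by simp only at h; omega
  unfold dtlct
  simp only [key, Finset.sum_mul]
  rw [hH, Finset.sum_mul, Finset.mul_sum, finsum_sum_comm]
  · refine Finset.sum_congr rfl fun k _ => ?_
    rw [← finsum_comp_equiv (Equiv.addRight k), mul_finsum, mul_finsum]
    refine finsum_congr fun n => ?_
    simp only [Equiv.coe_addRight, add_sub_cancel_right]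
    have (u v p q r s t : ℂ) (hpq : p + q = r + (s + t)) :
        u * v * Complex.exp p * Complex.exp q =
          Complex.exp r * (u * Complex.exp s * (v * Complex.exp t)) := by
      have := congrArg Complex.exp hpq
      simp only [Complex.exp_add] at this
      linear_combination u * v * this
    apply this
    push_cast
    ring
  · intro k _
    refine (hxs k).subset fun n hn h0 => hn ?_
    simp [show x (n - k) = 0 from h0]

theorem poly0_lctConv (a b T : ℝ) {h x : ℤ → ℂ} (hh : (Function.support h).Finite) (n : ℤ) :
    poly0 (lctConv a b T h x) n = lctConv a b (2 * T) (poly0 h) (poly0 x) n +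
      lctConv a b (2 * T) (poly1T2 a b T h) (poly1T1 a b T x) n := by
  unfold poly0 lctConv poly1T1 poly1T2
  rw [finsum_int_eq_even_add_odd]
  · congr 1
    · refine finsum_congr fun k => ?_
      rw [← mul_sub]
      congr 3
      push_cast
      ring
    · refine finsum_congr fun k => ?_
      rw [show 2 * n - (2 * k + 1) = 2 * (n - k) - 1 by ring]
      have (u v p q r s : ℂ) (hpq : p = q + r + s) : u * v * Complex.exp p =
          u * Complex.exp q * (v * Complex.exp r) * Complex.exp s := by
        rw [hpq, Complex.exp_add, Complex.exp_add]
        ring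
      apply this
      push_cast
      ring
  · simp only [mul_assoc]
    exact support_mul_finite_of_left hh _

theorem up2_two_mul (y : ℤ → ℂ) (n : ℤ) : up2 y (2 * n) = y n := by
  simp [up2]

theorem up2_two_mul_add_one (y : ℤ → ℂ) (n : ℤ) : up2 y (2 * n + 1) = 0 :=
  if_neg (by omega)

theorem poly0_lctConv_up2 (a b T : ℝ) {g : ℤ → ℂ} (hg : (Function.support g).Finite)
    (y : ℤ → ℂ) :
    poly0 (lctConv a b T g (up2 y)) = lctConv a b (2 * T) (poly0 g) y := by
  ext n
  have h1 : poly1T1 a b T (up2 y) = 0 := by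
    ext m
    simp [poly1T1, show 2 * m - 1 = 2 * (m - 1) + 1 by ring, up2_two_mul_add_one]
  have h0 : poly0 (up2 y) = y := funext (up2_two_mul y)
  rw [poly0_lctConv a b T hg, h0, h1]
  simp [lctConv]

theorem poly1T1_lctConv_up2 (a b T : ℝ) {g : ℤ → ℂ} (hg : (Function.support g).Finite)
    (y : ℤ → ℂ) :
    poly1T1 a b T (lctConv a b T g (up2 y)) = lctConv a b (2 * T) (poly1T1 a b T g) y := by
  ext n
  unfold poly1T1 lctConv
  rw [finsum_int_eq_even_add_odd]
  · have hE (k : ℤ) : up2 y (2 * n - 1 - 2 * k) = 0 := by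
      rw [show 2 * n - 1 - 2 * k = 2 * (n - k - 1) + 1 by ring, up2_two_mul_add_one]
    simp only [hE, mul_zero, zero_mul, finsum_zero, zero_add]
    rw [← finsum_comp_equiv (Equiv.subRight (1 : ℤ)), finsum_mul]
    refine finsum_congr fun k => ?_
    simp only [Equiv.subRight_apply]
    rw [show 2 * n - 1 - (2 * (k - 1) + 1) = 2 * (n - k) by ring, up2_two_mul,
      show 2 * (k - 1) + 1 = 2 * k - 1 by ring]
    have (u v p q r s : ℂ) (hpq : p + q = r + s) : u * v * Complex.exp p * Complex.exp q =
        u * Complex.exp r * v * Complex.exp s := by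
      have := congrArg Complex.exp hpq
      simp only [Complex.exp_add] at this
      linear_combination u * v * this
    apply this
    push_cast
    ring
  · simp only [mul_assoc]
    exact support_mul_finite_of_left hg _

/-- Two-channel LCT filter bank in polyphase form:
`X̂_p(ω) = exp(−i·d·b·ω²/(4T²))·G_p(ω)·H_p(ω)·X_p(ω)`, where `H_p(ω)` has `(i,j)` entry
the DTLCT (period `2T`) of the `j`-th type-2 polyphase component of `hᵢ`, and `G_p(ω)`
has `(j,i)` entry the DTLCT (period `2T`) of the `j`-th type-1 polyphase component of `gᵢ`. -/
theorem dtlct_filter_bank_polyphase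
    (a b c d T : ℝ) (hb : 0 < b) (habcd : a * d - b * c = 1) (hT : 0 < T)
    (h₀ h₁ g₀ g₁ x : ℤ → ℂ)
    (hh₀ : (Function.support h₀).Finite) (hh₁ : (Function.support h₁).Finite)
    (hg₀ : (Function.support g₀).Finite) (hg₁ : (Function.support g₁).Finite)
    (hx : (Function.support x).Finite)
    (xhat : ℤ → ℂ)
    (hxhat : ∀ n : ℤ,
      xhat n = lctConv a b T g₀ (up2 (down2 (lctConv a b T h₀ x))) n +
               lctConv a b T g₁ (up2 (down2 (lctConv a b T h₁ x))) n) :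
    ∀ ω : ℝ,
      ![dtlct a b d (2 * T) (poly0 xhat) ω,
        dtlct a b d (2 * T) (poly1T1 a b T xhat) ω] =
      Complex.exp (-Complex.I * ((d * b * ω ^ 2 / (4 * T ^ 2) : ℝ) : ℂ)) •
        ((!![dtlct a b d (2 * T) (poly0 g₀) ω, dtlct a b d (2 * T) (poly0 g₁) ω;
             dtlct a b d (2 * T) (poly1T1 a b T g₀) ω,
               dtlct a b d (2 * T) (poly1T1 a b T g₁) ω] *
          !![dtlct a b d (2 * T) (poly0 h₀) ω, dtlct a b d (2 * T) (poly1T2 a b T h₀) ω;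
             dtlct a b d (2 * T) (poly0 h₁) ω,
               dtlct a b d (2 * T) (poly1T2 a b T h₁) ω]).mulVec
          ![dtlct a b d (2 * T) (poly0 x) ω,
            dtlct a b d (2 * T) (poly1T1 a b T x) ω]) := by
  intro ω
  have hch {h : ℤ → ℂ} (hh : (Function.support h).Finite) :
      (Function.support (down2 (lctConv a b T h x))).Finite :=
    support_poly0_finite (support_lctConv_finite a b T hh hx)
  have hdown {h : ℤ → ℂ} (hh : (Function.support h).Finite) :
      dtlct a b d (2 * T) (down2 (lctConv a b T h x)) ω =
        Complex.exp (-Complex.I * ((d * b * ω ^ 2 / (2 * (2 * T) ^ 2) : ℝ) : ℂ)) *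
          (dtlct a b d (2 * T) (poly0 h) ω * dtlct a b d (2 * T) (poly0 x) ω +
            dtlct a b d (2 * T) (poly1T2 a b T h) ω *
              dtlct a b d (2 * T) (poly1T1 a b T x) ω) := by
    have hE := support_poly0_finite hh
    have hO := support_poly1T2_finite a b T hh
    have hxE := support_poly0_finite hx
    have hxO := support_poly1T1_finite a b T hx
    rw [show down2 (lctConv a b T h x) = _ from funext (poly0_lctConv a b T hh),
      dtlct_add _ _ _ _ (support_lctConv_finite _ _ _ hE hxE)
        (support_lctConv_finite _ _ _ hO hxO),
      dtlct_lctConv _ _ _ _ hE hxE, dtlct_lctConv _ _ _ _ hO hxO, mul_add]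
  have h0 : poly0 xhat = fun n =>
      lctConv a b (2 * T) (poly0 g₀) (down2 (lctConv a b T h₀ x)) n +
        lctConv a b (2 * T) (poly0 g₁) (down2 (lctConv a b T h₁ x)) n := by
    rw [← poly0_lctConv_up2 a b T hg₀, ← poly0_lctConv_up2 a b T hg₁]
    exact funext fun n => hxhat (2 * n)
  have h1 : poly1T1 a b T xhat = fun n =>
      lctConv a b (2 * T) (poly1T1 a b T g₀) (down2 (lctConv a b T h₀ x)) n +
        lctConv a b (2 * T) (poly1T1 a b T g₁) (down2 (lctConv a b T h₁ x)) n := by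
    rw [← poly1T1_lctConv_up2 a b T hg₀, ← poly1T1_lctConv_up2 a b T hg₁]
    ext n
    simp only [poly1T1, hxhat, add_mul]
  have hconv {u v : ℤ → ℂ} (hu : (Function.support u).Finite)
      (hv : (Function.support v).Finite) :
      dtlct a b d (2 * T) (fun n => lctConv a b (2 * T) u (down2 (lctConv a b T h₀ x)) n +
        lctConv a b (2 * T) v (down2 (lctConv a b T h₁ x)) n) ω =
      Complex.exp (-Complex.I * ((d * b * ω ^ 2 / (2 * (2 * T) ^ 2) : ℝ) : ℂ)) *
        (dtlct a b d (2 * T) u ω * dtlct a b d (2 * T) (down2 (lctConv a b T h₀ x)) ω +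
          dtlct a b d (2 * T) v ω * dtlct a b d (2 * T) (down2 (lctConv a b T h₁ x)) ω) := by
    rw [dtlct_add _ _ _ _ (support_lctConv_finite _ _ _ hu (hch hh₀))
        (support_lctConv_finite _ _ _ hv (hch hh₁)),
      dtlct_lctConv _ _ _ _ hu (hch hh₀), dtlct_lctConv _ _ _ _ hv (hch hh₁), mul_add]
  have hphase : Complex.exp (-Complex.I * ((d * b * ω ^ 2 / (4 * T ^ 2) : ℝ) : ℂ)) =
      Complex.exp (-Complex.I * ((d * b * ω ^ 2 / (2 * (2 * T) ^ 2) : ℝ) : ℂ)) *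
        Complex.exp (-Complex.I * ((d * b * ω ^ 2 / (2 * (2 * T) ^ 2) : ℝ) : ℂ)) := by
    rw [← Complex.exp_add]
    congr 1
    push_cast
    ring
  rw [h0, h1, hconv (support_poly0_finite hg₀) (support_poly0_finite hg₁),
    hconv (support_poly1T1_finite a b T hg₀) (support_poly1T1_finite a b T hg₁),
    hdown hh₀, hdown hh₁, hphase]
  ext i
  fin_cases i <;> simp <;> ring
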